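/- Let ⋆ be a homogeneous preserving semistar operation on R and let V be a gr-valuation overring of R. Then V is a gr-⋆-valuation overring of R if and only if there exists a valuation subring W of K(X) containing KR(R,⋆_a) such that V is the set of all finite sums of elements x ∈ K that are homogeneous elements of R_H and lie in W (that is, V = ⊕_{α∈⟨Γ⟩}(W ∩ (R_H)_α)). -/

import Mathlib

open Pointwise

section
/- `Γ` is a nonzero torsionless (i.e. admitting a compatible total order) cancellative
commutative monoid, `A` is an integral domain graded by `Γ` via `𝒜`, with quotient
field `K`. -/
variable {Γ : Type*} [AddCommMonoid Γ] [LinearOrder Γ]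
  [CovariantClass Γ Γ (· + ·) (· < ·)] [Nontrivial Γ]
variable {A : Type*} [CommRing A] [IsDomain A]
variable {K : Type*} [Field K] [Algebra A K] [IsFractionRing A K]

instance : SMulCommClass K A K := SMulCommClass.symm A K K

variable (𝒜 : Γ → AddSubgroup A) [GradedRing 𝒜]

/-- `a` is a nonzero homogeneous element of the graded domain `A`. -/
def IsHomog (a : A) : Prop := a ≠ 0 ∧ ∃ γ : Γ, a ∈ 𝒜 γ

/-- `x ∈ K` is a (nonzero) homogeneous element of the homogeneous quotient ring `R_H`,
i.e. `x = a/s` with `a` a nonzero homogeneous element and `s ∈ H`. -/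
def IsHomogElem (x : K) : Prop :=
  ∃ a s : A, IsHomog 𝒜 a ∧ IsHomog 𝒜 s ∧ x * algebraMap A K s = algebraMap A K a

/-- `x ∈ K` belongs to the homogeneous quotient ring `R_H`. -/
def MemRH (x : K) : Prop :=
  ∃ a s : A, IsHomog 𝒜 s ∧ x * algebraMap A K s = algebraMap A K a

/-- The image in `K` of an integral ideal of `A`. -/
def idealToK (I : Ideal A) : Submodule A K := Submodule.map (Algebra.linearMap A K) I

/-- `E` is a homogeneous fractional ideal of `A`: `sE` is (the image in `K` of) a
homogeneous integral ideal for some nonzero homogeneous `s`. -/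
def IsHomogFrac (E : Submodule A K) : Prop :=
  ∃ s : A, IsHomog 𝒜 s ∧ ∃ I : Ideal A, Ideal.IsHomogeneous 𝒜 I ∧
    algebraMap A K s • E = idealToK (K := K) I

/-- The four axioms of a semistar operation, imposed on nonzero `A`-submodules of `K`. -/
def IsSemistar (star : Submodule A K → Submodule A K) : Prop :=
  (∀ x : K, x ≠ 0 → ∀ E : Submodule A K, E ≠ ⊥ → star (x • E) = x • star E) ∧
  (∀ E F : Submodule A K, E ≠ ⊥ → E ≤ F → star E ≤ star F) ∧
  (∀ E : Submodule A K, E ≠ ⊥ → E ≤ star E) ∧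
  (∀ E : Submodule A K, E ≠ ⊥ → star (star E) = star E)

/-- `star` is homogeneous preserving. -/
def HomogPres (star : Submodule A K → Submodule A K) : Prop :=
  ∀ E : Submodule A K, E ≠ ⊥ → IsHomogFrac 𝒜 E → IsHomogFrac 𝒜 (star E)

/-- Membership in `E^{⋆_f} = ⋃ {F^⋆ : F nonzero finitely generated, F ⊆ E}`. -/
def MemStarF (star : Submodule A K → Submodule A K) (E : Submodule A K) (x : K) : Prop :=
  ∃ F : Submodule A K, F ≠ ⊥ ∧ F.FG ∧ F ≤ E ∧ x ∈ star F

/-- `star` is of finite type, i.e. `⋆ = ⋆_f`. -/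
def IsFiniteType (star : Submodule A K → Submodule A K) : Prop :=
  ∀ E : Submodule A K, E ≠ ⊥ → ∀ x : K, x ∈ star E ↔ MemStarF star E x

/-- Membership in `E^{⋆_a}`:  `F^{⋆_a} = ⋃ {((FG)^⋆ : G^⋆) : G nonzero f.g.}` for f.g. `F`,
and `E^{⋆_a} = ⋃ {F^{⋆_a} : F ⊆ E nonzero f.g.}`. -/
def MemStarA (star : Submodule A K → Submodule A K) (E : Submodule A K) (x : K) : Prop :=
  ∃ F : Submodule A K, F ≠ ⊥ ∧ F.FG ∧ F ≤ E ∧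
    ∃ G : Submodule A K, G ≠ ⊥ ∧ G.FG ∧ ∀ y ∈ star G, x * y ∈ star (F * G)

/-- Membership in `E^{⋆_{a(h)}}`: as in `⋆_a` but with `G` ranging over nonzero finitely
generated *homogeneous* fractional ideals. -/
def MemStarAH (star : Submodule A K → Submodule A K) (E : Submodule A K) (x : K) : Prop :=
  ∃ F : Submodule A K, F ≠ ⊥ ∧ F.FG ∧ F ≤ E ∧
    ∃ G : Submodule A K, G ≠ ⊥ ∧ G.FG ∧ IsHomogFrac 𝒜 G ∧ ∀ y ∈ star G, x * y ∈ star (F * G)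

/-- `star` is graded-e.a.b. -/
def IsGrEab (star : Submodule A K → Submodule A K) : Prop :=
  ∀ E F G : Submodule A K,
    E ≠ ⊥ → E.FG → IsHomogFrac 𝒜 E →
    F ≠ ⊥ → F.FG → IsHomogFrac 𝒜 F →
    G ≠ ⊥ → G.FG → IsHomogFrac 𝒜 G →
    star (E * F) ≤ star (E * G) → star F ≤ star G

/-- The `A`-submodule of `K` generated by all products `e * v`, `e ∈ E`, `v ∈ S`
(e.g. `EV` for an overring `V`). -/
def mulSet (E : Submodule A K) (S : Set K) : Submodule A K :=
  Submodule.span A {z : K | ∃ e ∈ E, ∃ v ∈ S, z = e * v}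

/-- The `b`-operation: `E^b = ⋂ {EV : V a valuation overring of A}`. -/
def bOp : Submodule A K → Submodule A K := fun E =>
  ⨅ (V : ValuationSubring K) (_ : ∀ a : A, algebraMap A K a ∈ V), mulSet E (V : Set K)

/-- The image of a polynomial over `A` in the rational function field `K(X)`. -/
noncomputable def polyToRatFunc (f : Polynomial A) : RatFunc K :=
  algebraMap (Polynomial K) (RatFunc K) (Polynomial.map (algebraMap A K) f)

/-- The content ideal `c(f)` of a polynomial. -/
def contentIdeal (f : Polynomial A) : Ideal A := Ideal.span (Set.range f.coeff)

/-- The homogeneous content ideal `𝒜_f`, generated by all homogeneous components of all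
coefficients of `f`. -/
def homogContentIdeal (f : Polynomial A) : Ideal A :=
  Ideal.span {a : A | ∃ (n : ℕ) (γ : Γ), a = (DirectSum.decompose 𝒜 (f.coeff n) γ : A)}

/-- The Kronecker function ring `Kr(R,⋆)` as a subset of `K(X)`. -/
def KrSet (star : Submodule A K → Submodule A K) : Set (RatFunc K) :=
  {q | ∃ f g h : Polynomial A, g ≠ 0 ∧ h ≠ 0 ∧
    q * polyToRatFunc (K := K) g = polyToRatFunc (K := K) f ∧
    idealToK (contentIdeal f * contentIdeal h) ≤ star (idealToK (contentIdeal g * contentIdeal h))}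

/-- The homogeneous Kronecker function ring `KR(R,⋆)` as a subset of `K(X)`. -/
def KRSet (star : Submodule A K → Submodule A K) : Set (RatFunc K) :=
  {q | ∃ f g h : Polynomial A, g ≠ 0 ∧ h ≠ 0 ∧
    q * polyToRatFunc (K := K) g = polyToRatFunc (K := K) f ∧
    idealToK (homogContentIdeal 𝒜 f * homogContentIdeal 𝒜 h) ≤
      star (idealToK (homogContentIdeal 𝒜 g * homogContentIdeal 𝒜 h))}

/-- `V` is a homogeneous overring of `A`: `R ⊆ V ⊆ R_H` and `V` is generated as an
additive group by its homogeneous elements. -/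
def IsHomogOverring (V : Subring K) : Prop :=
  (∀ a : A, algebraMap A K a ∈ V) ∧ (∀ x ∈ V, MemRH 𝒜 x) ∧
  (∀ v ∈ V, v ∈ AddSubgroup.closure {x : K | x ∈ V ∧ IsHomogElem 𝒜 x})

/-- `V` is a gr-valuation overring of `A`. -/
def IsGrValOverring (V : Subring K) : Prop :=
  IsHomogOverring 𝒜 V ∧ ∀ x : K, IsHomogElem 𝒜 x → x ∈ V ∨ x⁻¹ ∈ V

/-- `V` is a gr-`⋆`-valuation overring of `A`: `F^⋆ ⊆ FV` for every nonzero finitely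
generated homogeneous fractional ideal `F`. -/
def IsGrStarValOverring (star : Submodule A K → Submodule A K) (V : Subring K) : Prop :=
  ∀ F : Submodule A K, F ≠ ⊥ → F.FG → IsHomogFrac 𝒜 F → star F ≤ mulSet F (V : Set K)

end

section ValuationExtension

/-- A prime ideal of a ring mapping to a field, containing the kernel, is the centre of some
valuation subring of that field. -/
theorem exists_valuationSubring_of_prime {B L : Type*} [CommRing B] [Field L] (j : B →+* L)
    (P : Ideal B) [P.IsPrime] (hj : RingHom.ker j ≤ P) :
    ∃ W : ValuationSubring L, (∀ b, W.valuation (j b) ≤ 1) ∧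
      ∀ b, W.valuation (j b) = 1 ↔ b ∉ P := by
  have hunit : ∀ y : P.primeCompl, IsUnit (j y) := fun y => by
    rw [isUnit_iff_ne_zero]
    exact fun h => y.2 (hj h)
  let l : Localization.AtPrime P →+* L := IsLocalization.lift (M := P.primeCompl) hunit
  have hl : ∀ b, l (algebraMap B _ b) = j b := fun b => IsLocalization.lift_eq hunit b
  obtain ⟨W, hW, hloc⟩ := IsLocalRing.exists_factor_valuationRing l
  have hmem : ∀ b, j b ∈ W := fun b => by
    rw [← hl]
    exact hW _
  refine ⟨W, fun b => (W.valuation_le_one_iff _).2 (hmem b), fun b => ?_⟩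
  have h1 : W.valuation (j b) = 1 ↔ IsUnit (⟨j b, hmem b⟩ : W) :=
    (W.valuation_eq_one_iff ⟨j b, hmem b⟩).symm
  have h2 : (⟨j b, hmem b⟩ : W) = l.codRestrict W.toSubring hW (algebraMap B _ b) :=
    Subtype.ext (hl b).symm
  rw [h1, h2]
  refine Iff.trans ⟨fun h => hloc.map_nonunit _ h, fun h => h.map _⟩ ?_
  exact IsLocalization.AtPrime.isUnit_to_map_iff (Localization.AtPrime P) P b

end ValuationExtension

section GradedValuation

set_option linter.unusedSectionVars false

variable {Γ : Type*} [AddCommMonoid Γ] [LinearOrder Γ]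
variable {A : Type*} [CommRing A] [IsDomain A]
variable {K : Type*} [Field K] [Algebra A K] [IsFractionRing A K]
variable {𝒜 : Γ → AddSubgroup A} [GradedRing 𝒜]

theorem IsHomog.mul {a b : A} (ha : IsHomog 𝒜 a) (hb : IsHomog 𝒜 b) : IsHomog 𝒜 (a * b) := by
  obtain ⟨ha0, α, ha⟩ := ha
  obtain ⟨hb0, β, hb⟩ := hb
  exact ⟨mul_ne_zero ha0 hb0, α + β, SetLike.mul_mem_graded ha hb⟩

theorem IsHomog.algebraMap_ne_zero {a : A} (ha : IsHomog 𝒜 a) : algebraMap A K a ≠ 0 :=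
  (map_ne_zero_iff _ (IsFractionRing.injective A K)).2 ha.1

theorem isHomogElem_iff_div {x : K} : IsHomogElem 𝒜 x ↔
    ∃ a s : A, IsHomog 𝒜 a ∧ IsHomog 𝒜 s ∧ x = algebraMap A K a / algebraMap A K s := by
  refine exists_congr fun a => exists_congr fun s => and_congr_right fun _ =>
    and_congr_right fun hs => ?_
  rw [eq_div_iff hs.algebraMap_ne_zero]

theorem IsHomogElem.ne_zero {x : K} (hx : IsHomogElem 𝒜 x) : x ≠ 0 := by
  obtain ⟨a, s, ha, hs, rfl⟩ := isHomogElem_iff_div.1 hx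
  exact div_ne_zero ha.algebraMap_ne_zero hs.algebraMap_ne_zero

theorem IsHomogElem.div {x y : K} (hx : IsHomogElem 𝒜 x) (hy : IsHomogElem 𝒜 y) :
    IsHomogElem 𝒜 (x / y) := by
  obtain ⟨a, s, ha, hs, rfl⟩ := isHomogElem_iff_div.1 hx
  obtain ⟨b, t, hb, ht, rfl⟩ := isHomogElem_iff_div.1 hy
  exact isHomogElem_iff_div.2 ⟨a * t, s * b, ha.mul ht, hs.mul hb, by
    rw [map_mul, map_mul, div_div_div_eq]⟩

theorem isHomogElem_one : IsHomogElem 𝒜 (1 : K) :=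
  ⟨1, 1, ⟨one_ne_zero, 0, SetLike.one_mem_graded 𝒜⟩, ⟨one_ne_zero, 0, SetLike.one_mem_graded 𝒜⟩,
    one_mul _⟩

theorem IsHomogElem.inv {x : K} (hx : IsHomogElem 𝒜 x) : IsHomogElem 𝒜 x⁻¹ := by
  simpa using isHomogElem_one.div hx

theorem IsHomogElem.neg {x : K} (hx : IsHomogElem 𝒜 x) : IsHomogElem 𝒜 (-x) := by
  obtain ⟨a, s, ⟨ha0, α, ha⟩, hs, h⟩ := hx
  exact ⟨-a, s, ⟨neg_ne_zero.2 ha0, α, neg_mem ha⟩, hs, by rw [neg_mul, h, map_neg]⟩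

/-- A gr-valuation overring has the same homogeneous elements as some valuation overring. -/
theorem IsGrValOverring.exists_valuationSubring {V : Subring K} (hV : IsGrValOverring 𝒜 V) :
    ∃ O : ValuationSubring K, ∀ x : K, IsHomogElem 𝒜 x → (x ∈ O ↔ x ∈ V) := by
  let m : Ideal V := Ideal.span {y : V | IsHomogElem 𝒜 (y : K) ∧ ¬ IsUnit y}
  have hm : ∀ x ∈ m, x = 0 ∨ ∃ y : V, (IsHomogElem 𝒜 (y : K) ∧ ¬ IsUnit y) ∧ y ∣ x := by
    intro x hx
    induction hx using Submodule.span_induction with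
    | mem y hy => exact Or.inr ⟨y, hy, dvd_rfl⟩
    | zero => exact Or.inl rfl
    | add x x' _ _ hx hx' =>
      rcases hx with rfl | ⟨y, hy, hyx⟩
      · simpa using hx'
      rcases hx' with rfl | ⟨y', hy', hyx'⟩
      · exact Or.inr ⟨y, hy, by simpa using hyx⟩
      rcases hV.2 _ (hy.1.div hy'.1) with h | h
      · have : y' ∣ y := ⟨⟨_, h⟩, Subtype.ext (mul_div_cancel₀ _ hy'.1.ne_zero).symm⟩
        exact Or.inr ⟨y', hy', dvd_add (this.trans hyx) hyx'⟩
      · rw [inv_div] at h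
        have : y ∣ y' := ⟨⟨_, h⟩, Subtype.ext (mul_div_cancel₀ _ hy.1.ne_zero).symm⟩
        exact Or.inr ⟨y, hy, dvd_add hyx (this.trans hyx')⟩
    | smul a x _ hx =>
      rcases hx with rfl | ⟨y, hy, hyx⟩
      · simp
      · exact Or.inr ⟨y, hy, hyx.mul_left a⟩
  have hm1 : m ≠ ⊤ := by
    rw [Ideal.ne_top_iff_one]
    intro h
    rcases hm 1 h with h | ⟨y, hy, h⟩
    · exact one_ne_zero h
    · exact hy.2 (isUnit_of_dvd_one h)
  obtain ⟨M, hM, hmM⟩ := Ideal.exists_le_maximal m hm1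
  have := hM.isPrime
  obtain ⟨O, hO, hO1⟩ := exists_valuationSubring_of_prime V.subtype M (by
    rw [(RingHom.injective_iff_ker_eq_bot _).1 Subtype.val_injective]
    exact bot_le)
  refine ⟨O, fun x hx => ⟨fun hxO => ?_, fun hxV => (O.valuation_le_one_iff _).1 (hO ⟨x, hxV⟩)⟩⟩
  by_contra hxV
  have hinv := (hV.2 x hx).resolve_left hxV
  have hmem : (⟨x⁻¹, hinv⟩ : V) ∈ M := by
    refine hmM (Ideal.subset_span ⟨hx.inv, fun hu => hxV ?_⟩)
    obtain ⟨z, hz⟩ := hu.exists_right_inv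
    have hz' : x⁻¹ * (z : K) = 1 := congrArg Subtype.val hz
    have : x = z := by
      rw [inv_mul_eq_one₀ hx.ne_zero] at hz'
      exact hz'
    rw [this]
    exact z.2
  refine absurd hmem ((hO1 _).1 (le_antisymm (hO _) ?_))
  have : O.valuation x ≤ 1 := (O.valuation_le_one_iff _).2 hxO
  simpa using (one_le_inv₀ ((Valuation.pos_iff _).2 hx.ne_zero)).2 this

end GradedValuation

section MonoidAlgebraValuation

open Polynomial

theorem uniqueSums_of_strictMono (Γ : Type*) [AddCommMonoid Γ] [LinearOrder Γ]
    [h : CovariantClass Γ Γ (· + ·) (· < ·)] : UniqueSums Γ := by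
  have : AddLeftStrictMono Γ := ⟨h.elim⟩
  have hl : IsLeftCancelAdd Γ := ⟨fun a b c hbc => by
    rcases lt_trichotomy b c with h | h | h
    · exact absurd hbc (add_lt_add_right h a).ne
    · exact h
    · exact absurd hbc (add_lt_add_right h a).ne'⟩
  have : IsRightCancelAdd Γ := AddCommMagma.IsLeftCancelAdd.toIsRightCancelAdd Γ
  infer_instance

/-- An element of a monoid algebra whose coefficients lie in the image of `f` lifts along `f`. -/
theorem AddMonoidAlgebra.mem_range_mapRingHom {R S M : Type*} [Ring R] [Ring S] [AddMonoid M]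
    (f : R →+* S) (x : AddMonoidAlgebra S M) (hx : ∀ m, x.coeff m ∈ Set.range f) :
    x ∈ Set.range (AddMonoidAlgebra.mapRingHom M f) := by
  choose r hr using hx
  change x ∈ (AddMonoidAlgebra.mapRingHom M f).range
  rw [← AddMonoidAlgebra.sum_coeff_single x]
  refine sum_mem fun m _ => ⟨AddMonoidAlgebra.single m (r m), ?_⟩
  rw [AddMonoidAlgebra.mapRingHom_single, hr]

theorem AddMonoidAlgebra.mapRingHom_injective {R S M : Type*} [Ring R] [Ring S] [AddMonoid M]
    {f : R →+* S} (hf : Function.Injective f) :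
    Function.Injective (AddMonoidAlgebra.mapRingHom M f) := by
  intro x y hxy
  ext m
  apply hf
  rw [← AddMonoidAlgebra.coeff_mapRingHom, hxy, AddMonoidAlgebra.coeff_mapRingHom]

/-- The Gauss extension of a valuation subring of `K` to a field containing `K[Γ][X]`. -/
theorem ValuationSubring.exists_gauss_extension {Γ K L : Type*} [AddCommMonoid Γ] [LinearOrder Γ]
    [CovariantClass Γ Γ (· + ·) (· < ·)] [Field K] [Field L] (O : ValuationSubring K)
    (e : (AddMonoidAlgebra K Γ)[X] →+* L) (he : Function.Injective e) :
    ∃ W : ValuationSubring L,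
      (∀ y : K, W.valuation (e (C (.single 0 y))) ≤ 1 ↔ y ∈ O) ∧
      (∀ (γ : Γ) (y : K), W.valuation (e (C (.single γ y))) = W.valuation (e (C (.single 0 y)))) ∧
      W.valuation (e X) ≤ 1 ∧
      ∀ (p : (AddMonoidAlgebra K Γ)[X]) (n : ℕ) (γ : Γ),
        W.valuation (e (C (.single γ ((p.coeff n).coeff γ)))) ≤ W.valuation (e p) := by
  have := uniqueSums_of_strictMono Γ
  let i : (AddMonoidAlgebra O Γ)[X] →+* (AddMonoidAlgebra K Γ)[X] :=
    mapRingHom (AddMonoidAlgebra.mapRingHom Γ O.subtype)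
  have hi : Function.Injective i :=
    Polynomial.map_injective _ (AddMonoidAlgebra.mapRingHom_injective Subtype.val_injective)
  let r : (AddMonoidAlgebra O Γ)[X] →+* (AddMonoidAlgebra (IsLocalRing.ResidueField O) Γ)[X] :=
    mapRingHom (AddMonoidAlgebra.mapRingHom Γ (IsLocalRing.residue O))
  let P : Ideal (AddMonoidAlgebra O Γ)[X] := RingHom.ker r
  have : P.IsPrime := RingHom.ker_isPrime r
  obtain ⟨W, hW, hW1⟩ := exists_valuationSubring_of_prime (B := (AddMonoidAlgebra O Γ)[X])
    (e.comp i) P (by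
    rw [(RingHom.injective_iff_ker_eq_bot _).1 fun _ _ h => hi (he h)]
    exact bot_le)
  simp only [RingHom.comp_apply, P, RingHom.mem_ker] at hW hW1
  have hiC : ∀ (γ : Γ) (y : O), i (C (.single γ y)) = C (.single γ (y : K)) := fun γ y => by
    simp [i]
  have hrC : ∀ (γ : Γ) (y : O), r (C (.single γ y)) = C (.single γ (IsLocalRing.residue O y)) :=
    fun γ y => by simp [r]
  have hT : ∀ γ : Γ, W.valuation (e (C (.single γ 1))) = 1 := fun γ => by
    have := (hW1 (C (.single γ 1))).2 (by rw [hrC]; simp)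
    rwa [hiC] at this
  have hmul : ∀ (γ : Γ) (y z : K), W.valuation (e (C (.single γ (y * z)))) =
      W.valuation (e (C (.single 0 y))) * W.valuation (e (C (.single γ z))) := fun γ y z => by
    rw [← map_mul, ← map_mul, ← C_mul, AddMonoidAlgebra.single_mul_single, zero_add]
  have hγ : ∀ (γ : Γ) (y : K),
      W.valuation (e (C (.single γ y))) = W.valuation (e (C (.single 0 y))) := fun γ y => by
    have := hmul γ y 1
    rwa [mul_one, hT, mul_one] at this
  have hle : ∀ y : K, y ∈ O → W.valuation (e (C (.single 0 y))) ≤ 1 := fun y hy => by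
    have := hW (C (.single 0 ⟨y, hy⟩))
    rwa [hiC] at this
  refine ⟨W, fun y => ⟨fun h => ?_, hle y⟩, hγ, ?_, fun p n γ => ?_⟩
  · by_contra hy
    have hy0 : y ≠ 0 := fun h0 => hy (h0 ▸ O.zero_mem)
    have hinv : y⁻¹ ∈ O := (O.mem_or_inv_mem y).resolve_left hy
    have hres : IsLocalRing.residue O ⟨y⁻¹, hinv⟩ = 0 := by
      rw [IsLocalRing.residue_eq_zero_iff, O.valuation_lt_one_iff]
      have : ¬ O.valuation y ≤ 1 := fun h => hy ((O.valuation_le_one_iff y).1 h)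
      simpa using inv_lt_one_of_one_lt₀ (not_le.1 this)
    have h1 := (hW1 (C (.single 0 ⟨y⁻¹, hinv⟩))).not.2 (by rw [hrC, hres]; simp)
    rw [hiC] at h1
    have h2 := hmul 0 y y⁻¹
    rw [mul_inv_cancel₀ hy0, hT] at h2
    exact h1 (le_antisymm (hle _ hinv) (h2.trans_le (mul_le_of_le_one_left' h)))
  · simpa [i] using hW X
  · by_cases hp : (p.coeff n).coeff γ = 0
    · simp [hp]
    obtain ⟨⟨n₀, γ₀⟩, hmem, hmax⟩ := Finset.exists_max_image
      (p.support.sigma fun n => (p.coeff n).coeff.support)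
      (fun q => O.valuation ((p.coeff q.1).coeff q.2)) ⟨⟨n, γ⟩, by
        simp only [Finset.mem_sigma, mem_support_iff, Finsupp.mem_support_iff]
        exact ⟨fun h => hp (by simp [h]), hp⟩⟩
    set d := (p.coeff n₀).coeff γ₀ with hd
    have hd0 : d ≠ 0 := by simpa [← hd] using (Finset.mem_sigma.1 hmem).2
    have hdiv : ∀ m δ, d⁻¹ * (p.coeff m).coeff δ ∈ O := fun m δ => by
      by_cases h0 : (p.coeff m).coeff δ = 0
      · rw [h0, mul_zero]
        exact O.zero_mem
      rw [← O.valuation_le_one_iff, map_mul, map_inv₀]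
      refine inv_mul_le_one_of_le₀ (hmax ⟨m, δ⟩ ?_) zero_le
      simp only [Finset.mem_sigma, mem_support_iff, Finsupp.mem_support_iff]
      exact ⟨fun h => h0 (by simp [h]), h0⟩
    have hcoeff : ∀ m δ, (((C (AddMonoidAlgebra.single 0 d⁻¹) * p).coeff m).coeff δ) =
        d⁻¹ * (p.coeff m).coeff δ := fun m δ => by
      rw [coeff_C_mul, AddMonoidAlgebra.coeff_single_zero_mul]
    obtain ⟨q, hq⟩ : ∃ q, i q = C (.single 0 d⁻¹) * p := by
      refine (Polynomial.mem_lifts _).1 ((Polynomial.lifts_iff_coeff_lifts _).2 fun m =>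
        AddMonoidAlgebra.mem_range_mapRingHom _ _ fun δ => ?_)
      rw [hcoeff]
      exact ⟨⟨_, hdiv m δ⟩, rfl⟩
    have hq1 : (q.coeff n₀).coeff γ₀ = 1 := by
      apply Subtype.ext
      have h1 : ((i q).coeff n₀).coeff γ₀ = ((q.coeff n₀).coeff γ₀ : K) := by
        simp [i]
      rw [← h1, hq, hcoeff, ← hd, inv_mul_cancel₀ hd0]
      rfl
    have hrq : r q ≠ 0 := fun h => by
      have h1 : ((r q).coeff n₀).coeff γ₀ = IsLocalRing.residue O ((q.coeff n₀).coeff γ₀) := by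
        simp [r]
      rw [h, hq1] at h1
      simp at h1
    have hval := (hW1 q).2 hrq
    rw [hq, map_mul, map_mul] at hval
    have hc : W.valuation (e (C (.single 0 (d⁻¹ * (p.coeff n).coeff γ)))) ≤ 1 := hle _ (hdiv n γ)
    rw [hmul] at hc
    rw [hγ]
    have hpos : 0 < W.valuation (e (C (.single 0 d⁻¹))) :=
      zero_lt_iff.2 fun h => by simp [h] at hval
    exact le_of_mul_le_mul_left (hc.trans hval.ge) hpos

end MonoidAlgebraValuation

section KroneckerValuation

open Polynomial

theorem ValuationSubring.valuation_comap_le_iff {F L : Type*} [Field F] [Field L]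
    (W : ValuationSubring L) (ψ : F →+* L) (x y : F) :
    (W.comap ψ).valuation x ≤ (W.comap ψ).valuation y ↔
      W.valuation (ψ x) ≤ W.valuation (ψ y) := by
  rcases eq_or_ne y 0 with rfl | hy
  · simp
  have hpos := (Valuation.pos_iff (W.comap ψ).valuation).2 hy
  have hpos' := (Valuation.pos_iff W.valuation).2 ((map_ne_zero ψ).2 hy)
  rw [← div_le_one₀ hpos, ← div_le_one₀ hpos', ← map_div₀, ← map_div₀, ← map_div₀,
    ValuationSubring.valuation_le_one_iff, ValuationSubring.valuation_le_one_iff,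
    ValuationSubring.mem_comap]

variable {Γ : Type*} [AddCommMonoid Γ] [LinearOrder Γ]
variable {A : Type*} [CommRing A]
variable {K : Type*} [Field K] [Algebra A K]

/-- The ring homomorphism `A → K[Γ]` recording the homogeneous components of an element. -/
noncomputable def componentsHom (K : Type*) [Field K] [Algebra A K] (𝒜 : Γ → AddSubgroup A)
    [GradedRing 𝒜] : A →+* AddMonoidAlgebra K Γ :=
  (DirectSum.toSemiring
    (fun γ => (AddMonoidAlgebra.singleAddHom γ).comp
      ((algebraMap A K).toAddMonoidHom.comp (𝒜 γ).subtype))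
    (by
      change AddMonoidAlgebra.single 0 (algebraMap A K 1) = 1
      rw [map_one]
      rfl)
    (fun {α β} a b => by
      change AddMonoidAlgebra.single (α + β) (algebraMap A K (a * b)) =
        AddMonoidAlgebra.single α (algebraMap A K a) * AddMonoidAlgebra.single β (algebraMap A K b)
      rw [AddMonoidAlgebra.single_mul_single, map_mul])).comp
    (DirectSum.decomposeRingEquiv 𝒜 : A →+* _)

variable (𝒜 : Γ → AddSubgroup A) [GradedRing 𝒜]

theorem componentsHom_of_mem {γ : Γ} {a : A} (ha : a ∈ 𝒜 γ) :
    componentsHom K 𝒜 a = AddMonoidAlgebra.single γ (algebraMap A K a) := by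
  have : DirectSum.decomposeRingEquiv 𝒜 a = DirectSum.of (fun i => 𝒜 i) γ ⟨a, ha⟩ :=
    DirectSum.decompose_of_mem 𝒜 ha
  simp [componentsHom, this]

theorem coeff_componentsHom (a : A) (γ : Γ) : (componentsHom K 𝒜 a).coeff γ =
    algebraMap A K (DirectSum.decompose 𝒜 a γ : A) := by
  induction a using DirectSum.Decomposition.inductionOn 𝒜 with
  | zero => simp
  | @homogeneous δ a =>
    rw [componentsHom_of_mem 𝒜 a.2, DirectSum.decompose_coe, AddMonoidAlgebra.coeff_single,
      Finsupp.single_apply]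
    split_ifs with h
    · subst h
      rw [DirectSum.of_eq_same]
    · rw [DirectSum.of_eq_of_ne _ _ _ (Ne.symm h)]
      simp
  | add a b ha hb => simp [ha, hb]

theorem componentsHom_injective [IsDomain A] [IsFractionRing A K] :
    Function.Injective (componentsHom K 𝒜) := by
  rw [injective_iff_map_eq_zero]
  intro a ha
  apply (DirectSum.decompose 𝒜).injective
  ext γ
  apply IsFractionRing.injective A K
  rw [← coeff_componentsHom, ha]
  simp

/-- A gr-valuation overring is cut out on homogeneous elements by a valuation subring of `K(X)`
for which the value of a polynomial dominates those of all homogeneous components of its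
coefficients. -/
theorem IsGrValOverring.exists_valuationSubring_ratFunc [CovariantClass Γ Γ (· + ·) (· < ·)]
    [IsDomain A] [IsFractionRing A K] {V : Subring K} (hV : IsGrValOverring 𝒜 V) :
    ∃ W : ValuationSubring (RatFunc K),
      (∀ x : K, IsHomogElem 𝒜 x → (algebraMap K (RatFunc K) x ∈ W ↔ x ∈ V)) ∧
      RatFunc.X ∈ W ∧
      ∀ (f : A[X]) (n : ℕ) (γ : Γ),
        W.valuation (algebraMap K (RatFunc K)
          (algebraMap A K (DirectSum.decompose 𝒜 (f.coeff n) γ : A))) ≤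
        W.valuation (polyToRatFunc (K := K) f) := by
  have := uniqueSums_of_strictMono Γ
  obtain ⟨O, hO⟩ := hV.exists_valuationSubring
  let Q := FractionRing (AddMonoidAlgebra K Γ)
  let e : (AddMonoidAlgebra K Γ)[X] →+* RatFunc Q :=
    (algebraMap Q[X] (RatFunc Q)).comp (mapRingHom (algebraMap (AddMonoidAlgebra K Γ) Q))
  have he : Function.Injective e := fun a b h =>
    Polynomial.map_injective _ (IsFractionRing.injective (AddMonoidAlgebra K Γ) Q)
      (RatFunc.algebraMap_injective Q h)
  obtain ⟨W, hW0, hWγ, hWX, hW⟩ := O.exists_gauss_extension e he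
  have hι : Function.Injective
      ((algebraMap (AddMonoidAlgebra K Γ) Q).comp (componentsHom K 𝒜)) := fun a b h =>
    componentsHom_injective 𝒜 (IsFractionRing.injective (AddMonoidAlgebra K Γ) Q h)
  let θ : K →+* Q := IsFractionRing.lift hι
  have hθ : ∀ a : A, θ (algebraMap A K a) = algebraMap _ Q (componentsHom K 𝒜 a) :=
    fun a => IsFractionRing.lift_algebraMap hι a
  let φ : K[X] →+* RatFunc Q := (algebraMap Q[X] (RatFunc Q)).comp (mapRingHom θ)
  have hφ : Function.Injective φ := fun a b h =>
    Polynomial.map_injective _ θ.injective (RatFunc.algebraMap_injective Q h)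
  let ψ : RatFunc K →+* RatFunc Q :=
    RatFunc.liftRingHom φ (nonZeroDivisors_le_comap_nonZeroDivisors_of_injective _ hφ)
  have hψ : ∀ p : K[X], ψ (algebraMap K[X] (RatFunc K) p) = φ p := fun p =>
    RatFunc.liftRingHom_algebraMap _ _ _
  have hψf : ∀ f : A[X], ψ (polyToRatFunc f) = e (f.map (componentsHom K 𝒜)) := fun f => by
    simp only [polyToRatFunc, hψ, φ, e, RingHom.comp_apply, coe_mapRingHom, Polynomial.map_map]
    congr 2
    ext a
    exact hθ a
  have hψa : ∀ (γ : Γ) (a : A), a ∈ 𝒜 γ → W.valuation (ψ (algebraMap K (RatFunc K)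
      (algebraMap A K a))) = W.valuation (e (C (.single 0 (algebraMap A K a)))) := fun γ a ha => by
    have : algebraMap K (RatFunc K) (algebraMap A K a) = polyToRatFunc (C a) := by
      simp [polyToRatFunc]
    rw [this, hψf, Polynomial.map_C, componentsHom_of_mem 𝒜 ha, hWγ]
  refine ⟨W.comap ψ, fun x hx => ?_, ?_, fun f n γ => ?_⟩
  · obtain ⟨a, s, ⟨ha0, α, ha⟩, ⟨hs0, σ, hs⟩, h⟩ := hx
    have hs0' : W.valuation (e (C (.single 0 (algebraMap A K s)))) ≠ 0 := by
      rw [← hψa σ s hs]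
      simpa using hs0
    have hval : W.valuation (ψ (algebraMap K (RatFunc K) x)) =
        W.valuation (e (C (.single 0 x))) := by
      apply mul_right_cancel₀ hs0'
      nth_rewrite 1 [← hψa σ s hs]
      rw [← map_mul, ← map_mul, ← map_mul, h, hψa α a ha, ← map_mul, ← map_mul, ← C_mul,
        AddMonoidAlgebra.single_mul_single, zero_add, h]
    rw [ValuationSubring.mem_comap, ← W.valuation_le_one_iff, hval, hW0]
    exact hO x ⟨a, s, ⟨ha0, α, ha⟩, ⟨hs0, σ, hs⟩, h⟩
  · rw [ValuationSubring.mem_comap, ← W.valuation_le_one_iff, ← RatFunc.algebraMap_X, hψ]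
    simpa [φ, e] using hWX
  · rw [ValuationSubring.valuation_comap_le_iff, hψf, hψa γ _ (SetLike.coe_mem _), ← hWγ γ,
      ← coeff_componentsHom, ← Polynomial.coeff_map]
    exact hW _ n γ

end KroneckerValuation

section HomogeneousContent

open Polynomial

set_option linter.unusedSectionVars false

variable {Γ : Type*} [AddCommMonoid Γ] [LinearOrder Γ]
variable {A : Type*} [CommRing A]
variable (𝒜 : Γ → AddSubgroup A) [GradedRing 𝒜]

theorem coeff_mem_homogContentIdeal (f : A[X]) (n : ℕ) : f.coeff n ∈ homogContentIdeal 𝒜 f := by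
  classical
  rw [← DirectSum.sum_support_decompose 𝒜 (f.coeff n)]
  exact sum_mem fun γ _ => Ideal.subset_span ⟨n, γ, rfl⟩

theorem isHomogeneous_homogContentIdeal (f : A[X]) :
    (homogContentIdeal 𝒜 f).IsHomogeneous 𝒜 := by
  refine Ideal.homogeneous_span 𝒜 _ ?_
  rintro _ ⟨n, γ, rfl⟩
  exact ⟨γ, SetLike.coe_mem _⟩

theorem homogContentIdeal_le {I : Ideal A} (hI : I.IsHomogeneous 𝒜) {f : A[X]}
    (hf : ∀ n, f.coeff n ∈ I) : homogContentIdeal 𝒜 f ≤ I := by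
  refine Ideal.span_le.2 ?_
  rintro _ ⟨n, γ, rfl⟩
  exact hI γ (hf n)

theorem homogContentIdeal_fg (f : A[X]) : (homogContentIdeal 𝒜 f).FG := by
  classical
  let T : Finset A := f.support.biUnion fun n =>
    (DirectSum.decompose 𝒜 (f.coeff n)).support.image fun γ =>
      (DirectSum.decompose 𝒜 (f.coeff n) γ : A)
  refine ⟨T, le_antisymm (Ideal.span_le.2 fun a ha => ?_) (Ideal.span_le.2 ?_)⟩
  · obtain ⟨n, -, ha⟩ := Finset.mem_biUnion.1 ha
    obtain ⟨γ, -, rfl⟩ := Finset.mem_image.1 ha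
    exact Ideal.subset_span ⟨n, γ, rfl⟩
  · rintro _ ⟨n, γ, rfl⟩
    by_cases h : DirectSum.decompose 𝒜 (f.coeff n) γ = 0
    · rw [h]
      exact zero_mem _
    · refine Ideal.subset_span (Finset.mem_biUnion.2 ⟨n, mem_support_iff.2 fun h0 => h ?_,
        Finset.mem_image.2 ⟨γ, DFinsupp.mem_support_iff.2 h, rfl⟩⟩)
      rw [h0, DirectSum.decompose_zero]
      rfl

theorem homogContentIdeal_ne_bot {f : A[X]} (hf : f ≠ 0) : homogContentIdeal 𝒜 f ≠ ⊥ := by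
  intro h
  apply hf
  ext n
  have := coeff_mem_homogContentIdeal 𝒜 f n
  rw [h] at this
  simpa using this

theorem homogContentIdeal_one : homogContentIdeal 𝒜 (1 : A[X]) = ⊤ := by
  rw [Ideal.eq_top_iff_one]
  simpa using coeff_mem_homogContentIdeal 𝒜 (1 : A[X]) 0

theorem exists_contentIdeal_eq {I : Ideal A} (hI : I.FG) : ∃ f : A[X], _root_.contentIdeal f = I := by
  classical
  obtain ⟨n, s, rfl⟩ := Submodule.fg_iff_exists_fin_generating_family.1 hI
  refine ⟨Polynomial.ofFn n s, le_antisymm (Ideal.span_le.2 ?_) (Submodule.span_le.2 ?_)⟩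
  · rintro _ ⟨i, rfl⟩
    rcases lt_or_ge i n with h | h
    · rw [Polynomial.ofFn_coeff_eq_val_of_lt s h]
      exact Submodule.subset_span ⟨_, rfl⟩
    · rw [Polynomial.ofFn_coeff_eq_zero_of_ge s h]
      exact zero_mem _
  · rintro _ ⟨i, rfl⟩
    exact Ideal.subset_span ⟨i, Polynomial.ofFn_coeff_eq_val_of_lt s i.2⟩

theorem exists_homogContentIdeal_eq {I : Ideal A} (hI : I.FG) (hhom : I.IsHomogeneous 𝒜) :
    ∃ f : A[X], homogContentIdeal 𝒜 f = I := by
  obtain ⟨f, rfl⟩ := exists_contentIdeal_eq hI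
  refine ⟨f, le_antisymm (homogContentIdeal_le 𝒜 hhom fun n => Ideal.subset_span ⟨n, rfl⟩)
    (Ideal.span_le.2 ?_)⟩
  rintro _ ⟨n, rfl⟩
  exact coeff_mem_homogContentIdeal 𝒜 f n

end HomogeneousContent

section FractionalIdeals

set_option linter.unusedSectionVars false

variable {Γ : Type*} [AddCommMonoid Γ] [LinearOrder Γ]
variable {A : Type*} [CommRing A] [IsDomain A]
variable {K : Type*} [Field K] [Algebra A K] [IsFractionRing A K]

theorem mem_idealToK {I : Ideal A} {x : K} : x ∈ idealToK I ↔ ∃ a ∈ I, algebraMap A K a = x :=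
  Iff.rfl

theorem algebraMap_mem_idealToK {I : Ideal A} {a : A} (ha : a ∈ I) :
    algebraMap A K a ∈ idealToK (K := K) I :=
  ⟨a, ha, rfl⟩

theorem idealToK_mono {I J : Ideal A} (h : I ≤ J) : idealToK (K := K) I ≤ idealToK J :=
  Submodule.map_mono h

theorem idealToK_mul (I J : Ideal A) :
    idealToK (K := K) (I * J) = idealToK I * idealToK J :=
  Submodule.map_mul I J (Algebra.ofId A K)

theorem idealToK_ne_bot {I : Ideal A} (hI : I ≠ ⊥) : idealToK (K := K) I ≠ ⊥ := by
  obtain ⟨a, ha, ha0⟩ := Submodule.exists_mem_ne_zero_of_ne_bot hI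
  exact (Submodule.ne_bot_iff _).2 ⟨_, algebraMap_mem_idealToK ha,
    (map_ne_zero_iff _ (IsFractionRing.injective A K)).2 ha0⟩

theorem Ideal.FG.idealToK {I : Ideal A} (hI : I.FG) : (idealToK (K := K) I).FG :=
  Submodule.FG.map _ hI

theorem fg_of_idealToK_fg {I : Ideal A} (hI : (idealToK (K := K) I).FG) : I.FG :=
  Submodule.fg_of_fg_map_injective (Algebra.linearMap A K) (IsFractionRing.injective A K) hI

theorem Submodule.FG.pointwise_smul' {E : Submodule A K} (hE : E.FG) (x : K) : (x • E).FG :=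
  hE.map (DistribSMul.toLinearMap A K x)

theorem pointwise_smul_ne_bot {E : Submodule A K} (hE : E ≠ ⊥) {x : K} (hx : x ≠ 0) :
    x • E ≠ ⊥ := by
  obtain ⟨y, hy, hy0⟩ := Submodule.exists_mem_ne_zero_of_ne_bot hE
  exact (Submodule.ne_bot_iff _).2 ⟨x * y, Submodule.smul_mem_pointwise_smul y x E hy,
    mul_ne_zero hx hy0⟩

/-- Every finitely generated submodule of `K` becomes an integral ideal after scaling. -/
theorem exists_smul_eq_idealToK {G : Submodule A K} (hG : G.FG) :
    ∃ t : K, t ≠ 0 ∧ ∃ J : Ideal A, t • G = idealToK J := by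
  obtain ⟨t, ht, hint⟩ := FractionalIdeal.isFractional_of_fg (S := nonZeroDivisors A) hG
  refine ⟨algebraMap A K t, IsFractionRing.to_map_ne_zero_of_mem_nonZeroDivisors ht,
    Submodule.comap (Algebra.linearMap A K) (algebraMap A K t • G), ?_⟩
  rw [idealToK, Submodule.map_comap_eq_of_le]
  intro x hx
  obtain ⟨y, hy, rfl⟩ := (Submodule.mem_smul_pointwise_iff_exists _ _ _).1 hx
  obtain ⟨a, ha⟩ := hint y hy
  exact ⟨a, by rw [smul_eq_mul, ← Algebra.smul_def, ← ha]; rfl⟩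

variable (𝒜 : Γ → AddSubgroup A) [GradedRing 𝒜]

theorem isHomogFrac_idealToK {I : Ideal A} (hI : I.IsHomogeneous 𝒜) :
    IsHomogFrac 𝒜 (idealToK (K := K) I) :=
  ⟨1, ⟨one_ne_zero, 0, SetLike.one_mem_graded 𝒜⟩, I, hI, by rw [map_one, one_smul]⟩

theorem mulSet_smul_le (x : K) (E : Submodule A K) (S : Set K) :
    mulSet (x • E) S ≤ x • mulSet E S := by
  refine Submodule.span_le.2 ?_
  rintro _ ⟨e, he, v, hv, rfl⟩
  obtain ⟨e, he', rfl⟩ := (Submodule.mem_smul_pointwise_iff_exists _ _ _).1 he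
  rw [smul_mul_assoc]
  exact Submodule.smul_mem_pointwise_smul _ _ _ (Submodule.subset_span ⟨e, he', v, hv, rfl⟩)

end FractionalIdeals

section ValuationBounds

open Polynomial

set_option linter.unusedSectionVars false

variable {Γ : Type*} [AddCommMonoid Γ] [LinearOrder Γ]
variable {A : Type*} [CommRing A]
variable {K : Type*} [Field K] [Algebra A K]

/-- The elements of value at most `c`, as a submodule over a ring of elements of value at
most one. -/
def valuationBall {Γ₀ : Type*} [LinearOrderedCommMonoidWithZero Γ₀] (v : Valuation K Γ₀)
    (hv : ∀ a : A, v (algebraMap A K a) ≤ 1) (c : Γ₀) : Submodule A K where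
  carrier := {x | v x ≤ c}
  add_mem' hx hy := v.map_add_le hx hy
  zero_mem' := by simp
  smul_mem' a x hx := by
    change v (a • x) ≤ c
    rw [Algebra.smul_def, map_mul]
    exact (mul_le_of_le_one_left' (hv a)).trans hx

theorem mem_valuationBall {Γ₀ : Type*} [LinearOrderedCommMonoidWithZero Γ₀] {v : Valuation K Γ₀}
    {hv : ∀ a : A, v (algebraMap A K a) ≤ 1} {c : Γ₀} {x : K} :
    x ∈ valuationBall v hv c ↔ v x ≤ c :=
  Iff.rfl

theorem mulSet_le_valuationBall {Γ₀ : Type*} [LinearOrderedCommMonoidWithZero Γ₀]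
    {v : Valuation K Γ₀} {hv : ∀ a : A, v (algebraMap A K a) ≤ 1} {c : Γ₀} {E : Submodule A K}
    {S : Set K} (hE : E ≤ valuationBall v hv c) (hS : ∀ x ∈ S, v x ≤ 1) :
    mulSet E S ≤ valuationBall v hv c := by
  refine Submodule.span_le.2 ?_
  rintro _ ⟨e, he, x, hx, rfl⟩
  change v (e * x) ≤ c
  rw [map_mul]
  exact (mul_le_of_le_one_right' (hS x hx)).trans (hE he)

theorem mul_le_valuationBall {Γ₀ : Type*} [LinearOrderedCommMonoidWithZero Γ₀]
    {v : Valuation K Γ₀} {hv : ∀ a : A, v (algebraMap A K a) ≤ 1} {c d : Γ₀}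
    {E F : Submodule A K} (hE : E ≤ valuationBall v hv c) (hF : F ≤ valuationBall v hv d) :
    E * F ≤ valuationBall v hv (c * d) := by
  refine Submodule.mul_le.2 fun x hx y hy => ?_
  change v (x * y) ≤ c * d
  rw [map_mul]
  exact mul_le_mul' (hE hx) (hF hy)

theorem polyToRatFunc_eq_sum (f : A[X]) : polyToRatFunc (K := K) f =
    ∑ n ∈ f.support, algebraMap K (RatFunc K) (algebraMap A K (f.coeff n)) * RatFunc.X ^ n := by
  rw [polyToRatFunc]
  nth_rewrite 1 [f.as_sum_support_C_mul_X_pow]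
  simp [Polynomial.map_sum, map_sum]

theorem polyToRatFunc_C (a : A) :
    polyToRatFunc (C a) = algebraMap K (RatFunc K) (algebraMap A K a) := by
  simp [polyToRatFunc]

theorem polyToRatFunc_ne_zero [IsDomain A] [IsFractionRing A K] {f : A[X]} (hf : f ≠ 0) :
    polyToRatFunc (K := K) f ≠ 0 := by
  rw [polyToRatFunc, Ne, FaithfulSMul.algebraMap_eq_zero_iff,
    Polynomial.map_eq_zero_iff (IsFractionRing.injective A K)]
  exact hf

variable {W : ValuationSubring (RatFunc K)}

theorem valuation_coeff_mul_X_pow_le (hX : RatFunc.X ∈ W) (x : RatFunc K) (n : ℕ) :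
    W.valuation (x * RatFunc.X ^ n) ≤ W.valuation x := by
  rw [map_mul, map_pow]
  exact mul_le_of_le_one_right' (pow_le_one' ((W.valuation_le_one_iff _).2 hX) n)

theorem valuation_polyToRatFunc_le (hX : RatFunc.X ∈ W) {f : A[X]} {c : W.ValueGroup}
    (hf : ∀ n, W.valuation (algebraMap K (RatFunc K) (algebraMap A K (f.coeff n))) ≤ c) :
    W.valuation (polyToRatFunc (K := K) f) ≤ c := by
  rw [polyToRatFunc_eq_sum]
  exact Valuation.map_sum_le _ fun n _ => (valuation_coeff_mul_X_pow_le hX _ n).trans (hf n)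

/-- Some homogeneous component of a coefficient of `f` has value at least that of `f`. -/
theorem exists_valuation_polyToRatFunc_le_component [IsDomain A] [IsFractionRing A K]
    (𝒜 : Γ → AddSubgroup A) [GradedRing 𝒜] (hX : RatFunc.X ∈ W) {f : A[X]} (hf : f ≠ 0) :
    ∃ n γ, W.valuation (polyToRatFunc (K := K) f) ≤ W.valuation (algebraMap K (RatFunc K)
      (algebraMap A K (DirectSum.decompose 𝒜 (f.coeff n) γ : A))) := by
  classical
  by_contra! h
  have h0 : W.valuation (polyToRatFunc (K := K) f) ≠ 0 :=
    (Valuation.ne_zero_iff _).2 (polyToRatFunc_ne_zero hf)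
  refine lt_irrefl (W.valuation (polyToRatFunc (K := K) f)) ?_
  nth_rewrite 1 [polyToRatFunc_eq_sum]
  refine Valuation.map_sum_lt _ h0 fun n _ =>
    (valuation_coeff_mul_X_pow_le hX _ n).trans_lt ?_
  rw [← DirectSum.sum_support_decompose 𝒜 (f.coeff n), map_sum, map_sum]
  exact Valuation.map_sum_lt _ h0 fun γ _ => h n γ

/-- Cancellation of a polynomial `p` whose value is controlled by its coefficients. -/
theorem valuation_le_of_forall_coeff_mul_le [IsDomain A] [IsFractionRing A K]
    (hX : RatFunc.X ∈ W) {p : A[X]} (hp : p ≠ 0) {x : K} {c : W.ValueGroup}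
    (h : ∀ n, W.valuation (algebraMap K (RatFunc K) (x * algebraMap A K (p.coeff n))) ≤
      c * W.valuation (polyToRatFunc (K := K) p)) :
    W.valuation (algebraMap K (RatFunc K) x) ≤ c := by
  rcases eq_or_ne x 0 with rfl | hx
  · simp
  have hx' : 0 < W.valuation (algebraMap K (RatFunc K) x) :=
    (Valuation.pos_iff _).2 ((_root_.map_ne_zero _).2 hx)
  have hp' : 0 < W.valuation (polyToRatFunc (K := K) p) :=
    (Valuation.pos_iff _).2 (polyToRatFunc_ne_zero hp)
  have := valuation_polyToRatFunc_le (f := p) hX (c := (W.valuation (algebraMap K (RatFunc K) x))⁻¹ *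
    (c * W.valuation (polyToRatFunc (K := K) p))) fun n => by
      rw [le_inv_mul_iff₀ hx', ← map_mul, ← map_mul]
      exact h n
  rw [le_inv_mul_iff₀ hx'] at this
  exact le_of_mul_le_mul_right this hp'

end ValuationBounds

section Main

open Polynomial

set_option linter.unusedSectionVars false

variable {Γ : Type*} [AddCommMonoid Γ] [LinearOrder Γ]
variable {A : Type*} [CommRing A] [IsDomain A]
variable {K : Type*} [Field K] [Algebra A K] [IsFractionRing A K]
variable {𝒜 : Γ → AddSubgroup A} [GradedRing 𝒜]
variable {star stara : Submodule A K → Submodule A K}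

/-- A gr-`⋆`-valuation overring comes from a valuation subring containing `KR(R,⋆_a)`. -/
theorem KRSet_subset_of_isGrStarValOverring (hstar : IsSemistar star)
    (ha : ∀ E : Submodule A K, E ≠ ⊥ → ∀ x : K, x ∈ stara E ↔ MemStarA star E x)
    {V : Subring K} (hA : ∀ a : A, algebraMap A K a ∈ V) (hV : IsGrStarValOverring 𝒜 star V)
    {W : ValuationSubring (RatFunc K)} (hVW : ∀ x ∈ V, algebraMap K (RatFunc K) x ∈ W)
    (hX : RatFunc.X ∈ W)
    (hcomp : ∀ (f : A[X]) (n : ℕ) (γ : Γ),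
      W.valuation (algebraMap K (RatFunc K)
        (algebraMap A K (DirectSum.decompose 𝒜 (f.coeff n) γ : A))) ≤
      W.valuation (polyToRatFunc (K := K) f)) :
    KRSet 𝒜 stara ⊆ (W : Set (RatFunc K)) := by
  let u : Valuation K W.ValueGroup := W.valuation.comap (algebraMap K (RatFunc K))
  have huV : ∀ x ∈ V, u x ≤ 1 := fun x hx => (W.valuation_le_one_iff _).2 (hVW x hx)
  have hu : ∀ a : A, u (algebraMap A K a) ≤ 1 := fun a => huV _ (hA a)
  have hball : ∀ f : A[X], idealToK (homogContentIdeal 𝒜 f) ≤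
      valuationBall u hu (W.valuation (polyToRatFunc (K := K) f)) := fun f => by
    rw [idealToK, homogContentIdeal, Ideal.span, Submodule.map_span, Submodule.span_le]
    rintro _ ⟨_, ⟨n, γ, rfl⟩, rfl⟩
    exact hcomp f n γ
  rintro q ⟨f, g, h, hg, hh, hq, hle⟩
  have hgh0 : homogContentIdeal 𝒜 g * homogContentIdeal 𝒜 h ≠ ⊥ :=
    mul_ne_zero (homogContentIdeal_ne_bot 𝒜 hg) (homogContentIdeal_ne_bot 𝒜 hh)
  have hghball := mul_le_valuationBall (hball g) (hball h)
  rw [← idealToK_mul] at hghball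
  have hstara : stara (idealToK (homogContentIdeal 𝒜 g * homogContentIdeal 𝒜 h)) ≤
      valuationBall u hu (W.valuation (polyToRatFunc (K := K) g) *
        W.valuation (polyToRatFunc (K := K) h)) := by
    intro x hx
    obtain ⟨F, hF0, -, hFE, G, hG0, hGfg, hFG⟩ := (ha _ (idealToK_ne_bot hgh0) x).1 hx
    obtain ⟨t, ht, J, hJ⟩ := exists_smul_eq_idealToK hGfg
    have hJfg : J.FG := fg_of_idealToK_fg (K := K) (hJ ▸ hGfg.pointwise_smul' t)
    obtain ⟨p, rfl⟩ := exists_contentIdeal_eq hJfg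
    have hp : p ≠ 0 := by
      rintro rfl
      refine pointwise_smul_ne_bot hG0 ht (hJ.trans ?_)
      have h0 : _root_.contentIdeal (0 : A[X]) = ⊥ := Ideal.span_eq_bot.2 (by
        rintro _ ⟨n, rfl⟩
        exact coeff_zero n)
      rw [h0, idealToK, Submodule.map_bot]
    have hFG0 : F * G ≠ ⊥ := mul_ne_zero hF0 hG0
    have hbound : star (t • (F * G)) ≤ valuationBall u hu
        (W.valuation (polyToRatFunc (K := K) g) * W.valuation (polyToRatFunc (K := K) h) *
          W.valuation (polyToRatFunc (K := K) p)) := by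
      let I := homogContentIdeal 𝒜 g * homogContentIdeal 𝒜 h * homogContentIdeal 𝒜 p
      have hI0 : I ≠ ⊥ := mul_ne_zero hgh0 (homogContentIdeal_ne_bot 𝒜 hp)
      have hIfg : I.FG := ((homogContentIdeal_fg 𝒜 g).mul (homogContentIdeal_fg 𝒜 h)).mul
        (homogContentIdeal_fg 𝒜 p)
      have hIhom : I.IsHomogeneous 𝒜 := ((isHomogeneous_homogContentIdeal 𝒜 g).mul
        (isHomogeneous_homogContentIdeal 𝒜 h)).mul (isHomogeneous_homogContentIdeal 𝒜 p)
      have hIball := mul_le_valuationBall hghball (hball p)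
      rw [← idealToK_mul] at hIball
      have hFGI : t • (F * G) ≤ idealToK I := by
        intro z hz
        obtain ⟨z', hz', rfl⟩ := (Submodule.mem_smul_pointwise_iff_exists _ _ _).1 hz
        refine Submodule.mul_induction_on (C := fun z => t • z ∈ idealToK I) hz'
          (fun y hy w hw => ?_) fun y w hy hw => ?_
        · have hw' : t • w ∈ idealToK (homogContentIdeal 𝒜 p) := by
            refine idealToK_mono (Ideal.span_le.2 ?_)
              (hJ ▸ Submodule.smul_mem_pointwise_smul w t G hw)
            rintro _ ⟨n, rfl⟩
            exact coeff_mem_homogContentIdeal 𝒜 p n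
          rw [← mul_smul_comm, idealToK_mul]
          exact Submodule.mul_mem_mul (hFE hy) hw'
        · rw [smul_add]
          exact add_mem hy hw
      exact (hstar.2.1 _ _ (pointwise_smul_ne_bot hFG0 ht) hFGI).trans
        ((hV _ (idealToK_ne_bot hI0) hIfg.idealToK (isHomogFrac_idealToK 𝒜 hIhom)).trans
          (mulSet_le_valuationBall hIball huV))
    refine mem_valuationBall.2 (valuation_le_of_forall_coeff_mul_le (x := x) hX hp fun n =>
      show u (x * algebraMap A K (p.coeff n)) ≤ _ from mem_valuationBall.1 (hbound ?_))
    have hn : algebraMap A K (p.coeff n) ∈ t • G := by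
      rw [hJ]
      exact algebraMap_mem_idealToK (Ideal.subset_span ⟨n, rfl⟩)
    obtain ⟨y, hy, hyn⟩ := (Submodule.mem_smul_pointwise_iff_exists _ _ _).1 hn
    rw [hstar.1 t ht _ hFG0, ← hyn, mul_smul_comm]
    exact Submodule.smul_mem_pointwise_smul _ _ _ (hFG y (hstar.2.2.1 G hG0 hy))
  have hfg : W.valuation (polyToRatFunc (K := K) f) ≤ W.valuation (polyToRatFunc (K := K) g) := by
    refine valuation_polyToRatFunc_le hX fun n =>
      valuation_le_of_forall_coeff_mul_le hX hh fun m =>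
        show u (algebraMap A K (f.coeff n) * algebraMap A K (h.coeff m)) ≤ _ from
          mem_valuationBall.1 (hstara (hle ?_))
    rw [← map_mul]
    exact algebraMap_mem_idealToK (Ideal.mul_mem_mul (coeff_mem_homogContentIdeal 𝒜 f n)
      (coeff_mem_homogContentIdeal 𝒜 h m))
  rw [← hq, map_mul] at hfg
  have hg' : 0 < W.valuation (polyToRatFunc (K := K) g) :=
    (Valuation.pos_iff _).2 (polyToRatFunc_ne_zero hg)
  exact (W.valuation_le_one_iff q).1 (le_of_mul_le_mul_right (hfg.trans_eq (one_mul _).symm) hg')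

/-- `⋆ ≤ ⋆_a` on finitely generated submodules. -/
theorem star_le_stara (hstar : IsSemistar star)
    (ha : ∀ E : Submodule A K, E ≠ ⊥ → ∀ x : K, x ∈ stara E ↔ MemStarA star E x)
    {E : Submodule A K} (hE : E ≠ ⊥) (hfg : E.FG) : star E ≤ stara E := by
  obtain ⟨hsmul, hmono, hext, hidem⟩ := hstar
  intro x hx
  have h1 : (1 : Submodule A K) ≠ ⊥ := one_ne_zero
  refine (ha E hE x).2 ⟨E, hE, hfg, le_rfl, 1, h1, ⟨{1}, by simp [Submodule.one_eq_span]⟩,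
    fun y hy => ?_⟩
  rw [mul_one]
  rcases eq_or_ne y 0 with rfl | hy0
  · rw [mul_zero]
    exact zero_mem _
  have hyE : y • E ≤ star E := by
    intro z hz
    obtain ⟨e, he, rfl⟩ := (Submodule.mem_smul_pointwise_iff_exists _ _ _).1 hz
    rcases eq_or_ne e 0 with rfl | he0
    · rw [smul_zero]
      exact zero_mem _
    have hle : e • (1 : Submodule A K) ≤ E := by
      intro w hw
      obtain ⟨v, hv, rfl⟩ := (Submodule.mem_smul_pointwise_iff_exists _ _ _).1 hw
      obtain ⟨a, rfl⟩ := Submodule.mem_one.1 hv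
      rw [smul_eq_mul, mul_comm, ← Algebra.smul_def]
      exact E.smul_mem a he
    refine hmono _ _ (pointwise_smul_ne_bot h1 he0) hle ?_
    rw [hsmul e he0 _ h1, smul_eq_mul, mul_comm]
    exact Submodule.smul_mem_pointwise_smul y e _ hy
  have := hmono _ _ (pointwise_smul_ne_bot hE hy0) hyE
  rw [hidem E hE, hsmul y hy0 E hE] at this
  rw [mul_comm]
  exact this (Submodule.smul_mem_pointwise_smul x y _ hx)

theorem X_mem_of_KRSet_subset (hstar : IsSemistar star)
    (ha : ∀ E : Submodule A K, E ≠ ⊥ → ∀ x : K, x ∈ stara E ↔ MemStarA star E x)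
    {W : ValuationSubring (RatFunc K)} (hKR : KRSet 𝒜 stara ⊆ (W : Set (RatFunc K))) :
    RatFunc.X ∈ W := by
  refine hKR ⟨X, 1, 1, one_ne_zero, one_ne_zero, by simp [polyToRatFunc], ?_⟩
  have htop : idealToK (K := K) (⊤ : Ideal A) ≠ ⊥ := idealToK_ne_bot top_ne_bot
  rw [homogContentIdeal_one, Ideal.mul_top, Ideal.mul_top]
  exact (idealToK_mono le_top).trans ((hstar.2.2.1 _ htop).trans
    (star_le_stara hstar ha htop (Ideal.FG.idealToK ⟨{1}, by simp⟩)))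

/-- A homogeneous element of `J^⋆` lies in `JV` when `V` is cut out by a valuation subring
containing `KR(R,⋆_a)`. -/
theorem mem_mulSet_of_KRSet_subset (hstar : IsSemistar star)
    (ha : ∀ E : Submodule A K, E ≠ ⊥ → ∀ x : K, x ∈ stara E ↔ MemStarA star E x)
    {V : Subring K} {W : ValuationSubring (RatFunc K)}
    (hKR : KRSet 𝒜 stara ⊆ (W : Set (RatFunc K)))
    (hVW : ∀ x : K, IsHomogElem 𝒜 x → algebraMap K (RatFunc K) x ∈ W → x ∈ V)
    {J : Ideal A} (hJ0 : J ≠ ⊥) (hJfg : J.FG) (hJ : J.IsHomogeneous 𝒜) {b : A}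
    (hb : IsHomog 𝒜 b) (hbJ : algebraMap A K b ∈ star (idealToK J)) :
    algebraMap A K b ∈ mulSet (idealToK J) (V : Set K) := by
  have hX := X_mem_of_KRSet_subset hstar ha hKR
  obtain ⟨g, rfl⟩ := exists_homogContentIdeal_eq 𝒜 hJfg hJ
  have hg : g ≠ 0 := by
    rintro rfl
    refine hJ0 (le_bot_iff.1 (homogContentIdeal_le 𝒜 (Ideal.IsHomogeneous.bot 𝒜) fun n => ?_))
    simp
  have hg0 := polyToRatFunc_ne_zero (K := K) hg
  have hspan : homogContentIdeal 𝒜 (C b) ≤ Ideal.span {b} := by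
    refine homogContentIdeal_le 𝒜 (Ideal.homogeneous_span 𝒜 _ ?_) fun n => ?_
    · rintro _ rfl
      exact hb.2
    · rw [coeff_C]
      split_ifs
      · exact Ideal.mem_span_singleton_self b
      · exact zero_mem _
  have hmem : algebraMap K (RatFunc K) (algebraMap A K b) / polyToRatFunc (K := K) g ∈ W := by
    refine hKR ⟨C b, g, 1, hg, one_ne_zero, ?_, ?_⟩
    · rw [div_mul_cancel₀ _ hg0, polyToRatFunc_C]
    · rw [homogContentIdeal_one, Ideal.mul_top, Ideal.mul_top]
      refine (idealToK_mono hspan).trans ?_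
      rw [idealToK, Ideal.span, Submodule.map_span, Submodule.span_le]
      rintro _ ⟨_, rfl, rfl⟩
      exact star_le_stara hstar ha (idealToK_ne_bot hJ0) hJfg.idealToK hbJ
  obtain ⟨n, γ, hle⟩ := exists_valuation_polyToRatFunc_le_component 𝒜 hX hg
  set d : A := (DirectSum.decompose 𝒜 (g.coeff n) γ : A) with hd
  have hd0 : algebraMap A K d ≠ 0 := fun h => by
    rw [h, map_zero, map_zero, le_zero_iff, Valuation.zero_iff] at hle
    exact hg0 hle
  have hdh : IsHomog 𝒜 d :=
    ⟨fun h => hd0 (by rw [h, map_zero]), γ, SetLike.coe_mem _⟩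
  have hbd : algebraMap A K b / algebraMap A K d ∈ V := by
    refine hVW _ (isHomogElem_iff_div.2 ⟨b, d, hb, hdh, rfl⟩) ?_
    rw [← W.valuation_le_one_iff, map_div₀] at hmem
    rw [← W.valuation_le_one_iff, map_div₀, map_div₀]
    have hgpos := (Valuation.pos_iff W.valuation).2 hg0
    rw [div_le_one₀ hgpos] at hmem
    rw [div_le_one₀ (hgpos.trans_le hle)]
    exact hmem.trans hle
  exact Submodule.subset_span ⟨algebraMap A K d,
    algebraMap_mem_idealToK (Ideal.subset_span ⟨n, γ, rfl⟩), _, hbd,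
    (mul_div_cancel₀ _ hd0).symm⟩

theorem isGrStarValOverring_of_KRSet_subset (hstar : IsSemistar star) (hhp : HomogPres 𝒜 star)
    (ha : ∀ E : Submodule A K, E ≠ ⊥ → ∀ x : K, x ∈ stara E ↔ MemStarA star E x)
    {V : Subring K} {W : ValuationSubring (RatFunc K)}
    (hKR : KRSet 𝒜 stara ⊆ (W : Set (RatFunc K)))
    (hVW : ∀ x : K, IsHomogElem 𝒜 x → algebraMap K (RatFunc K) x ∈ W → x ∈ V) :
    IsGrStarValOverring 𝒜 star V := by
  classical
  intro F hF0 hFfg hFhom y hy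
  obtain ⟨s', hs', I', hI', hI'eq⟩ := hhp F hF0 hFhom
  obtain ⟨s, hs, I, hI, hIeq⟩ := hFhom
  have hs0 : algebraMap A K s ≠ 0 := hs.algebraMap_ne_zero
  have hs0' : algebraMap A K s' ≠ 0 := hs'.algebraMap_ne_zero
  have hss0 : algebraMap A K (s' * s) ≠ 0 := by
    rw [map_mul]
    exact mul_ne_zero hs0' hs0
  have hIfg : I.FG := fg_of_idealToK_fg (K := K) (hIeq ▸ hFfg.pointwise_smul' _)
  have hI0 : I ≠ ⊥ := by
    rintro rfl
    refine pointwise_smul_ne_bot hF0 hs0 (hIeq.trans ?_)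
    simp [idealToK]
  let J : Ideal A := Ideal.span {s'} * I
  have hJ0 : J ≠ ⊥ := mul_ne_zero (by simpa using hs'.1) hI0
  have hJfg : J.FG := Ideal.FG.mul ⟨{s'}, by simp⟩ hIfg
  have hJ : J.IsHomogeneous 𝒜 := by
    refine Ideal.IsHomogeneous.mul (Ideal.homogeneous_span 𝒜 _ ?_) hI
    rintro _ rfl
    exact hs'.2
  have hJeq : idealToK (K := K) J = algebraMap A K (s' * s) • F := by
    rw [map_mul, mul_smul, hIeq]
    ext x
    rw [mem_idealToK, Submodule.mem_smul_pointwise_iff_exists]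
    constructor
    · rintro ⟨a, haJ, rfl⟩
      obtain ⟨c, hc, rfl⟩ := Ideal.mem_span_singleton_mul.1 haJ
      exact ⟨_, algebraMap_mem_idealToK hc, by rw [smul_eq_mul, map_mul]⟩
    · rintro ⟨_, ⟨c, hc, rfl⟩, rfl⟩
      exact ⟨s' * c, Ideal.mem_span_singleton_mul.2 ⟨c, hc, rfl⟩, by
        rw [map_mul, smul_eq_mul]; rfl⟩
  have hy' : algebraMap A K s' • y ∈ idealToK (K := K) I' :=
    hI'eq ▸ Submodule.smul_mem_pointwise_smul _ _ _ hy
  obtain ⟨a, haI', hay⟩ := mem_idealToK.1 hy'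
  suffices h : ∀ γ, (algebraMap A K s')⁻¹ * algebraMap A K (DirectSum.decompose 𝒜 a γ : A) ∈
      mulSet F (V : Set K) by
    have hysum : y = ∑ γ ∈ (DirectSum.decompose 𝒜 a).support,
        (algebraMap A K s')⁻¹ * algebraMap A K (DirectSum.decompose 𝒜 a γ : A) := by
      rw [← Finset.mul_sum, ← map_sum, DirectSum.sum_support_decompose, hay, smul_eq_mul,
        inv_mul_cancel_left₀ hs0']
    rw [hysum]
    exact sum_mem fun γ _ => h γ
  intro γ
  set c : A := (DirectSum.decompose 𝒜 a γ : A) with hc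
  rcases eq_or_ne c 0 with h0 | h0
  · rw [h0, map_zero, mul_zero]
    exact zero_mem _
  have hcI : algebraMap A K c ∈ algebraMap A K s' • star F := by
    rw [hI'eq]
    exact algebraMap_mem_idealToK (hI' γ haI')
  obtain ⟨z, hz, hzc⟩ := (Submodule.mem_smul_pointwise_iff_exists _ _ _).1 hcI
  rw [← hzc, smul_eq_mul, inv_mul_cancel_left₀ hs0']
  have hsc : algebraMap A K (s * c) = algebraMap A K (s' * s) • z := by
    rw [map_mul, ← hzc, map_mul, smul_eq_mul, smul_eq_mul]
    ring
  have hmem := mem_mulSet_of_KRSet_subset hstar ha hKR hVW hJ0 hJfg hJ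
    (hs.mul ⟨h0, γ, SetLike.coe_mem _⟩) (b := s * c) (by
      rw [hJeq, hstar.1 _ hss0 F hF0, hsc]
      exact Submodule.smul_mem_pointwise_smul _ _ _ hz)
  rw [hJeq, hsc] at hmem
  obtain ⟨w, hw, hwz⟩ := (Submodule.mem_smul_pointwise_iff_exists _ _ _).1
    (mulSet_smul_le _ _ _ hmem)
  rwa [← smul_right_injective K hss0 hwz]

end Main

/-- Let `⋆` be a homogeneous preserving semistar operation on the graded
domain `R` and `V` a gr-valuation overring of `R`. Then `V` is a gr-`⋆`-valuation overring
of `R` iff there is a valuation subring `W` of `K(X)` containing `KR(R,⋆_a)` such that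
`V` is the set of finite sums of homogeneous elements of `R_H` lying in `W`. -/
theorem grStarVal_iff_exists_valuation_over_KR
    {Γ : Type*} [AddCommMonoid Γ] [LinearOrder Γ]
    [CovariantClass Γ Γ (· + ·) (· < ·)] [Nontrivial Γ]
    {A : Type*} [CommRing A] [IsDomain A]
    {K : Type*} [Field K] [Algebra A K] [IsFractionRing A K]
    (𝒜 : Γ → AddSubgroup A) [GradedRing 𝒜]
    (star stara : Submodule A K → Submodule A K)
    (hstar : IsSemistar star) (hhp : HomogPres 𝒜 star)
    (ha : ∀ E : Submodule A K, E ≠ ⊥ → ∀ x : K, x ∈ stara E ↔ MemStarA star E x)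
    (V : Subring K) (hV : IsGrValOverring 𝒜 V) :
    IsGrStarValOverring 𝒜 star V ↔
      ∃ W : ValuationSubring (RatFunc K), KRSet 𝒜 stara ⊆ (W : Set (RatFunc K)) ∧
        (V : Set K) = (AddSubmonoid.closure
          {x : K | IsHomogElem 𝒜 x ∧ algebraMap K (RatFunc K) x ∈ W} : AddSubmonoid K) := by
  obtain ⟨hVA, -, hVgen⟩ := hV.1
  constructor
  · intro hVstar
    obtain ⟨W, hVW, hX, hcomp⟩ := hV.exists_valuationSubring_ratFunc
    have hVW' : ∀ x ∈ V, algebraMap K (RatFunc K) x ∈ W := fun x hx => by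
      refine (AddSubgroup.closure_le (W.comap (algebraMap K (RatFunc K))).toSubring.toAddSubgroup).2
        ?_ (hVgen x hx)
      exact fun y hy => (hVW y hy.2).2 hy.1
    refine ⟨W, KRSet_subset_of_isGrStarValOverring hstar ha hVA hVstar hVW' hX hcomp,
      Set.Subset.antisymm (fun x hx => ?_) ?_⟩
    · refine AddSubgroup.closure_induction (p := fun y _ => y ∈ AddSubmonoid.closure
        {x : K | IsHomogElem 𝒜 x ∧ algebraMap K (RatFunc K) x ∈ W})
        (fun y hy => AddSubmonoid.subset_closure ⟨hy.2, hVW' y hy.1⟩) (zero_mem _)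
        (fun _ _ _ _ => add_mem) (fun y _ hy => ?_) (hVgen x hx)
      refine AddSubmonoid.closure_induction (motive := fun y _ => -y ∈ AddSubmonoid.closure
        {x : K | IsHomogElem 𝒜 x ∧ algebraMap K (RatFunc K) x ∈ W})
        (fun z hz => AddSubmonoid.subset_closure ⟨hz.1.neg, ?_⟩) (by simp)
        (fun a b _ _ ha hb => ?_) hy
      · rw [map_neg]
        exact neg_mem hz.2
      · rw [neg_add]
        exact add_mem ha hb
    · exact (AddSubmonoid.closure_le (S := V.toAddSubgroup.toAddSubmonoid)).2
        fun y hy => (hVW y hy.1).1 hy.2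
  · rintro ⟨W, hKR, hVeq⟩
    refine isGrStarValOverring_of_KRSet_subset hstar hhp ha hKR fun x hx hxW => ?_
    rw [← SetLike.mem_coe, hVeq]
    exact AddSubmonoid.subset_closure ⟨hx, hxW⟩
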